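/- Let b = (b_i)_{i∈ℤ} be a biinfinite sequence with every b_i ∈ {0,1}. If both constant sequences 𝟎 and 𝟏 belong to X_b, the closure of the shift orbit of b, then the closure of the numerical range of A_b equals the convex hull of the union of the spectra of A_𝟎 and A_𝟏: closure(W(A_b)) = conv(σ(A_𝟎) ∪ σ(A_𝟏)). -/

import Mathlib

open scoped ComplexConjugate ENNReal
open Filter

noncomputable section

/-- `ℓ²(ℤ)`, the Hilbert space of square-summable biinfinite complex sequences. -/
abbrev Hseq : Type := lp (fun _ : ℤ => ℂ) 2

/-- `A` is the (bounded) tridiagonal operator `A_b` associated to the biinfinite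
sequence `b`, i.e. `(A x) j = x (j+1) + b (j-1) * x (j-1)`. -/
def IsTridiag (b : ℤ → ℂ) (A : Hseq →L[ℂ] Hseq) : Prop :=
  ∀ x : Hseq, ∀ j : ℤ,
    (A x : ℤ → ℂ) j = (x : ℤ → ℂ) (j + 1) + b (j - 1) * (x : ℤ → ℂ) (j - 1)

/-- The numerical range `W(A) = {⟨Ax, x⟩ : ‖x‖ = 1}`, where
`⟨u, v⟩ = ∑ₖ uₖ · conj(vₖ)`; in Mathlib's convention this is `⟪x, A x⟫_ℂ`. -/
def numRange (A : Hseq →L[ℂ] Hseq) : Set ℂ :=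
  {z | ∃ x : Hseq, ‖x‖ = 1 ∧ (inner (𝕜 := ℂ) x (A x) : ℂ) = z}

/-- The shift orbit `Orb(b) = {φⁿ(b) : n ∈ ℤ}` where `(φⁿ(b))ᵢ = b_{i+n}`. -/
def shiftOrbit (b : ℤ → ℂ) : Set (ℤ → ℂ) :=
  {c | ∃ n : ℤ, c = fun i => b (i + n)}

lemma aux_inner (b : ℤ → ℂ) (hb : ∀ i, b i = 0 ∨ b i = 1)
    (Ab : Hseq →L[ℂ] Hseq) (hAb : IsTridiag b Ab)
    (A0 : Hseq →L[ℂ] Hseq) (hA0 : IsTridiag (fun _ => (0 : ℂ)) A0) (x : Hseq) :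
    HasSum (fun j : ℤ => conj (x j) * x (j+1) + b j * conj (conj (x j) * x (j+1)))
      (inner ℂ x (Ab x)) := by
  have e1 := lp.hasSum_inner (𝕜 := ℂ) x (Ab x)
  have e0 := lp.hasSum_inner (𝕜 := ℂ) x (A0 x)
  have e2 := e1.sub e0
  have e3 := (Equiv.addRight (1:ℤ)).hasSum_iff.mpr e2
  have e4 := e0.add e3
  rw [add_sub_cancel] at e4
  have hf : ∀ j : ℤ, conj (x j) * x (j+1) + b j * conj (conj (x j) * x (j+1)) =
      inner ℂ (x j) ((A0 x) j) +
        (inner ℂ (x (j+1)) ((Ab x) (j+1)) - inner ℂ (x (j+1)) ((A0 x) (j+1))) := by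
    intro j
    rw [hAb x (j+1), hA0 x (j+1), hA0 x j]
    simp
    ring
  rw [funext hf]
  exact e4

lemma aux_norm (x : Hseq) : HasSum (fun j : ℤ => ‖x j‖ ^ 2) (‖x‖ ^ 2) := by
  have := lp.hasSum_norm (p := 2) (by norm_num) x
  simpa using this

lemma aux_norm0 (A0 : Hseq →L[ℂ] Hseq) (hA0 : IsTridiag (fun _ => (0 : ℂ)) A0) (x : Hseq) :
    ‖A0 x‖ = ‖x‖ := by
  have h1 := aux_norm (A0 x)
  have h2 := (Equiv.addRight (1:ℤ)).hasSum_iff.mpr (aux_norm x)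
  have h3 : (fun j : ℤ => ‖(A0 x) j‖ ^ 2) = (fun j : ℤ => ‖x j‖ ^ 2) ∘ Equiv.addRight (1:ℤ) := by
    funext j
    simp [hA0 x j]
  rw [h3] at h1
  have := h1.unique h2
  exact (sq_eq_sq₀ (norm_nonneg _) (norm_nonneg _)).mp this

lemma aux_inv (A0 : Hseq →L[ℂ] Hseq) (hA0 : IsTridiag (fun _ => (0 : ℂ)) A0)
    (A1 : Hseq →L[ℂ] Hseq) (hA1 : IsTridiag (fun _ => (1 : ℂ)) A1) :
    A0 * (A1 - A0) = 1 ∧ (A1 - A0) * A0 = 1 := by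
  constructor
  · ext x j
    simp [hA0 _ j, hA1 _ (j+1), hA0 _ (j+1)]
  · ext x j
    simp [hA0 _ j, hA1 _ j]
    rw [hA0 x (j-1)]
    simp

lemma aux_spec0_sub (A0 : Hseq →L[ℂ] Hseq) (hA0 : IsTridiag (fun _ => (0 : ℂ)) A0)
    (A1 : Hseq →L[ℂ] Hseq) (hA1 : IsTridiag (fun _ => (1 : ℂ)) A1) (w : ℂ)
    (hw : w ∈ spectrum ℂ A0) : ‖w‖ = 1 := by
  obtain ⟨i1, i2⟩ := aux_inv A0 hA0 A1 hA1
  set R := A1 - A0 with hR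
  let U : (Hseq →L[ℂ] Hseq)ˣ := ⟨A0, R, i1, i2⟩
  have n0 : ‖A0‖ ≤ 1 := A0.opNorm_le_bound zero_le_one (fun x => by simp [aux_norm0 A0 hA0 x])
  have n1 : ‖R‖ ≤ 1 := R.opNorm_le_bound zero_le_one (fun x => by
    have : A0 (R x) = x := DFunLike.congr_fun i1 x
    rw [← aux_norm0 A0 hA0 (R x), this, one_mul])
  have : Nontrivial Hseq := ⟨lp.single 2 (0:ℤ) (1:ℂ), 0, fun h => by
    have := congrArg (fun f : Hseq => f 0) h
    simp at this⟩
  have hw' : w ∈ spectrum ℂ (U : Hseq →L[ℂ] Hseq) := hw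
  have w0 : w ≠ 0 := spectrum.ne_zero_of_mem_of_unit hw'
  have h1 : ‖w‖ ≤ 1 := (spectrum.norm_le_norm_of_mem hw).trans n0
  have h2 : ((Units.mk0 w w0)⁻¹ : ℂˣ).val ∈ spectrum ℂ (U⁻¹ : (Hseq →L[ℂ] Hseq)ˣ).val :=
    spectrum.inv_mem_iff.mp hw'
  have h3 : ‖w⁻¹‖ ≤ 1 := by
    have := (spectrum.norm_le_norm_of_mem h2).trans n1
    simpa using this
  rw [norm_inv] at h3
  have : 0 < ‖w‖ := norm_pos_iff.mpr w0
  have := (inv_le_one₀ this).mp h3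
  linarith

lemma aux_spec0_sup (A0 : Hseq →L[ℂ] Hseq) (hA0 : IsTridiag (fun _ => (0 : ℂ)) A0) (w : ℂ)
    (hw : ‖w‖ = 1) : w ∈ spectrum ℂ A0 := by
  rw [spectrum.mem_iff]
  rintro ⟨U, hU⟩
  set y : Hseq := U⁻¹.val (lp.single 2 (0:ℤ) (1:ℂ)) with hy
  have h1 : (U.val) y = lp.single 2 (0:ℤ) (1:ℂ) := by
    have := U.mul_inv
    exact DFunLike.congr_fun this _
  have h2 : ∀ j : ℤ, w * y j - y (j+1) = if j = 0 then 1 else 0 := by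
    intro j
    have := congrArg (fun f : Hseq => f j) h1
    rw [hU] at this
    have h5 : w * y j - (A0 y) j = (lp.single 2 (0:ℤ) (1:ℂ) : Hseq) j := this
    rw [hA0 y j, zero_mul, add_zero] at h5
    rw [h5]
    by_cases h : j = 0
    · subst h; simp
    · simp [h]
  have hs := (aux_norm y).summable
  have ht := hs.tendsto_cofinite_zero
  have h3 : ∀ j : ℤ, j ≠ 0 → ‖y (j+1)‖ = ‖y j‖ := by
    intro j hj
    have := h2 j
    rw [if_neg hj, sub_eq_zero] at this
    rw [← this, norm_mul, hw, one_mul]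
  have hp : ∀ n : ℕ, ‖y (1 + n)‖ = ‖y 1‖ := by
    intro n
    induction n with
    | zero => simp
    | succ n ih => rw [← ih, ← h3 (1+n) (by omega)]; push_cast; ring_nf
  have hn : ∀ n : ℕ, ‖y (-n)‖ = ‖y 0‖ := by
    intro n
    induction n with
    | zero => simp
    | succ n ih => rw [← ih, ← h3 (-(n+1:ℕ)) (by omega)]; push_cast; ring_nf
  have t1 : ‖y 1‖ = 0 := by
    have a : Tendsto (fun n : ℕ => ‖y (1+n)‖^2) atTop (nhds 0) := by
      rw [← Nat.cofinite_eq_atTop]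
      exact ht.comp (Function.Injective.tendsto_cofinite (f := fun n : ℕ => (1 + n : ℤ)) (fun a b h => by simpa using h))
    simp only [hp] at a
    simpa using tendsto_nhds_unique tendsto_const_nhds a
  have t0 : ‖y 0‖ = 0 := by
    have a : Tendsto (fun n : ℕ => ‖y (-n)‖^2) atTop (nhds 0) := by
      rw [← Nat.cofinite_eq_atTop]
      exact ht.comp (Function.Injective.tendsto_cofinite (f := fun n : ℕ => (-n : ℤ)) (fun a b h => by simpa using h))
    simp only [hn] at a
    simpa using tendsto_nhds_unique tendsto_const_nhds a
  have := h2 0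
  rw [norm_eq_zero] at t0 t1
  simp [t0, t1] at this

lemma aux_spec1 (A0 : Hseq →L[ℂ] Hseq) (hA0 : IsTridiag (fun _ => (0 : ℂ)) A0)
    (A1 : Hseq →L[ℂ] Hseq) (hA1 : IsTridiag (fun _ => (1 : ℂ)) A1) (w : ℂ) (hw : w ≠ 0) :
    w + w⁻¹ ∈ spectrum ℂ A1 ↔ w ∈ spectrum ℂ A0 ∨ w⁻¹ ∈ spectrum ℂ A0 := by
  obtain ⟨i1, i2⟩ := aux_inv A0 hA0 A1 hA1
  let U : (Hseq →L[ℂ] Hseq)ˣ := ⟨A0, _, i1, i2⟩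
  have hc : Commute (algebraMap ℂ (Hseq →L[ℂ] Hseq) w - A0) (algebraMap ℂ _ w⁻¹ - A0) := by
    refine Commute.sub_left ?_ ?_
    · exact Algebra.commute_algebraMap_left _ _
    · exact (Algebra.commute_algebraMap_right _ _).sub_right (Commute.refl _)
  have key : A0 * (algebraMap ℂ (Hseq →L[ℂ] Hseq) (w + w⁻¹) - A1) =
     - ((algebraMap ℂ (Hseq →L[ℂ] Hseq) w - A0) * (algebraMap ℂ _ w⁻¹ - A0)) := by
    have e : A0 * A1 = 1 + A0 * A0 := by
      rw [mul_sub] at i1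
      exact sub_eq_iff_eq_add.mp i1
    rw [mul_sub, e, sub_mul, mul_sub, mul_sub, ← map_mul, mul_inv_cancel₀ hw, map_one, map_add, mul_add,
      Algebra.commutes w A0]
    abel
  rw [spectrum.mem_iff, spectrum.mem_iff, spectrum.mem_iff, ← not_and_or, ← hc.isUnit_mul_iff,
    ← IsUnit.neg_iff (_ * _), ← key]
  exact (Units.isUnit_units_mul U _).symm.not

lemma aux_window (b : ℤ → ℂ) (hb : ∀ i, b i = 0 ∨ b i = 1) (c : ℂ) (hc : c = 0 ∨ c = 1)
    (h : (fun _ : ℤ => c) ∈ closure (shiftOrbit b)) (n : ℕ) :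
    ∃ N : ℤ, ∀ i : ℤ, N ≤ i → i < N + n → b i = c := by
  have ho : IsOpen (Set.pi (↑(Finset.Ico (0:ℤ) n)) (fun _ : ℤ => Metric.ball c 1)) :=
    isOpen_set_pi (Finset.finite_toSet _) (fun _ _ => Metric.isOpen_ball)
  obtain ⟨f, hf, N, rfl⟩ := mem_closure_iff.mp h _ ho (fun i _ => by simp)
  refine ⟨N, fun i h1 h2 => ?_⟩
  have := hf (i - N) (by simp; omega)
  simp only [sub_add_cancel] at this
  rw [Metric.mem_ball, dist_eq_norm] at this
  have hbi := hb i
  generalize b i = β at this hbi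
  clear h hf ho hb
  rcases hbi with rfl | rfl <;> rcases hc with rfl | rfl <;> simp at this ⊢

lemma aux_window2 (b : ℤ → ℂ) (hb : ∀ i, b i = 0 ∨ b i = 1) (c : ℂ) (hc : c = 0 ∨ c = 1)
    (h : (fun _ : ℤ => c) ∈ closure (shiftOrbit b)) (n M : ℕ) :
    ∃ N : ℤ, ∀ i : ℤ, N ≤ i → i < N + n → b i = c ∧ (M:ℤ) < |i| := by
  obtain ⟨N, hN⟩ := aux_window b hb c hc h (2 * n + 2 * M + 1)
  by_cases h1 : N + n - 1 < -M
  · refine ⟨N, fun i a1 a2 => ⟨hN i a1 (by push_cast; omega), ?_⟩⟩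
    rw [lt_abs]; omega
  · refine ⟨N + n + 2 * M + 1, fun i a1 a2 => ⟨hN i (by omega) (by push_cast; omega), ?_⟩⟩
    rw [lt_abs]; omega

def Gset (A : Hseq →L[ℂ] Hseq) : Set ℂ :=
  {z | ∀ ε > 0, ∀ M : ℕ, ∃ x : Hseq, ‖x‖ = 1 ∧
    (∃ M' : ℕ, ∀ j : ℤ, x j ≠ 0 → (M : ℤ) < |j| ∧ |j| ≤ M') ∧ ‖inner ℂ x (A x) - z‖ < ε}

lemma aux_test (b : ℤ → ℂ) (hb : ∀ i, b i = 0 ∨ b i = 1)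
    (Ab : Hseq →L[ℂ] Hseq) (hAb : IsTridiag b Ab)
    (A0 : Hseq →L[ℂ] Hseq) (hA0 : IsTridiag (fun _ => (0 : ℂ)) A0)
    (c : ℂ) (hc : c = 0 ∨ c = 1) (h : (fun _ : ℤ => c) ∈ closure (shiftOrbit b))
    (w : ℂ) (hw : ‖w‖ = 1) : w + c * conj w ∈ Gset Ab := by
  intro ε hε M
  obtain ⟨m, hm⟩ := exists_nat_gt (2 / ε)
  obtain ⟨N, hN⟩ := aux_window2 b hb c hc h (m+1) M
  have hw0 : w ≠ 0 := by rintro rfl; simp at hw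
  have hm1 : (0:ℝ) < m + 1 := by positivity
  let s : ℝ := (Real.sqrt (m+1))⁻¹
  have hs0 : 0 ≤ s := by positivity
  have hss : s * s = ((m:ℝ)+1)⁻¹ := by
    simp only [s]; rw [← mul_inv, Real.mul_self_sqrt hm1.le]
  let f : ℤ → ℂ := fun j => if N ≤ j ∧ j < N + (m + 1 : ℕ) then w ^ j * s else 0
  have hfs : ∀ j, j ∉ Finset.Ico N (N + (m+1:ℕ)) → f j = 0 := by
    intro j hj
    rw [Finset.mem_Ico] at hj
    exact if_neg hj
  have hfin : Set.Finite {j | f j ≠ 0} :=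
    (Finset.finite_toSet (Finset.Ico N (N + (m+1:ℕ)))).subset (fun j hj => by
      by_contra h'
      exact hj (hfs j h'))
  let x : Hseq := ⟨f, (memℓp_zero hfin).of_exponent_ge (zero_le)⟩
  have hxf : ∀ j, x j = f j := fun j => rfl
  have hwj : ∀ j : ℤ, ‖w ^ j‖ = 1 := fun j => by rw [norm_zpow, hw, one_zpow]
  refine ⟨x, ?_, ?_, ?_⟩
  · have h1 := aux_norm x
    have h2 : HasSum (fun j : ℤ => ‖x j‖ ^ 2) (∑ j ∈ Finset.Ico N (N + (m+1:ℕ)), ‖x j‖ ^ 2) :=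
      hasSum_sum_of_ne_finset_zero (fun j hj => by rw [hxf, hfs j hj]; simp)
    have h3 : ∑ j ∈ Finset.Ico N (N + (m+1:ℕ)), ‖x j‖ ^ 2 = 1 := by
      rw [Finset.sum_congr rfl (g := fun _ => ((m:ℝ)+1)⁻¹)]
      · simp; field_simp
      · intro j hj
        rw [Finset.mem_Ico] at hj
        rw [hxf]
        simp only [f]
        rw [if_pos hj, norm_mul, hwj, one_mul, Complex.norm_real, Real.norm_of_nonneg hs0, sq, hss]
    have h4 := h1.unique h2
    rw [h3] at h4
    exact (pow_eq_one_iff_of_nonneg (norm_nonneg _) two_ne_zero).mp h4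
  · refine ⟨N.natAbs + (m + 1), fun j hj => ?_⟩
    rw [hxf] at hj
    have hj' : j ∈ Finset.Ico N (N + (m+1:ℕ)) := by
      by_contra h'; exact hj (hfs j h')
    rw [Finset.mem_Ico] at hj'
    refine ⟨(hN j hj'.1 hj'.2).2, ?_⟩
    rw [abs_le]
    omega
  · have h1 := aux_inner b hb Ab hAb A0 hA0 x
    have h2 : HasSum (fun j : ℤ => conj (x j) * x (j+1) + b j * conj (conj (x j) * x (j+1)))
      (∑ j ∈ Finset.Ico N (N + m), (conj (x j) * x (j+1) + b j * conj (conj (x j) * x (j+1)))) := by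
      refine hasSum_sum_of_ne_finset_zero (fun j hj => ?_)
      have : conj (x j) * x (j+1) = 0 := by
        rw [Finset.mem_Ico] at hj
        rw [hxf, hxf]
        by_cases h' : j < N
        · rw [hfs j (by rw [Finset.mem_Ico]; omega)]; simp
        · rw [hfs (j+1) (by rw [Finset.mem_Ico]; push_cast; omega)]; simp
      rw [this]; simp
    have h3 : (∑ j ∈ Finset.Ico N (N + m),
        (conj (x j) * x (j+1) + b j * conj (conj (x j) * x (j+1)))) =
        m * ((w + c * conj w) * ((m:ℝ)+1)⁻¹) := by
      rw [Finset.sum_congr rfl (g := fun _ => ((w + c * conj w) * ((m:ℝ)+1)⁻¹))]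
      · simp
      · intro j hj
        rw [Finset.mem_Ico] at hj
        have e1 : conj (x j) * x (j+1) = w * ((m:ℝ)+1)⁻¹ := by
          rw [hxf, hxf]
          simp only [f]
          rw [if_pos (by push_cast; omega), if_pos (by push_cast; omega), zpow_add_one₀ hw0]
          have e2 : conj (w ^ j) * w ^ j = 1 := by
            rw [mul_comm, Complex.mul_conj, Complex.normSq_eq_norm_sq, hwj]; simp
          have e3 : (s:ℂ) * s = ((m:ℝ)+1)⁻¹ := by
            rw [← Complex.ofReal_mul, hss]
          rw [map_mul, Complex.conj_ofReal, ← e3]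
          linear_combination (w * s * s) * e2
        rw [e1, (hN j hj.1 (by push_cast; omega)).1]
        simp
        ring
    rw [h1.unique h2, h3]
    have e : (m:ℂ) * ((w + c * conj w) * (((m:ℝ)+1)⁻¹ : ℝ)) - (w + c * conj w) =
        - ((w + c * conj w) * (((m:ℝ)+1 : ℝ):ℂ)⁻¹) := by
      have : ((m:ℝ):ℂ) + 1 ≠ 0 := by exact_mod_cast hm1.ne'
      push_cast at this ⊢
      field_simp
      ring
    rw [e, norm_neg, norm_mul, norm_inv, Complex.norm_real, Real.norm_of_nonneg hm1.le]
    have hv : ‖w + c * conj w‖ ≤ 2 := by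
      refine (norm_add_le _ _).trans ?_
      rw [norm_mul, RCLike.norm_conj, hw]
      rcases hc with h' | h' <;> rw [h'] <;> norm_num
    rw [← div_eq_mul_inv, div_lt_iff₀ hm1]
    rw [div_lt_iff₀ hε] at hm
    nlinarith

lemma aux_orth (x y : Hseq) (h : ∀ j : ℤ, x j = 0 ∨ y j = 0) : inner ℂ x y = (0:ℂ) := by
  have h1 := lp.hasSum_inner (𝕜 := ℂ) x y
  have h2 : ∀ j : ℤ, inner ℂ (x j) (y j) = (0:ℂ) := by
    intro j
    rcases h j with h | h <;> rw [h] <;> simp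
  simp only [h2] at h1
  exact h1.unique hasSum_zero

lemma aux_convex (b : ℤ → ℂ) (A : Hseq →L[ℂ] Hseq) (hA : IsTridiag b A) :
    Convex ℝ (Gset A) := by
  intro z hz z' hz' t s ht hs hts ε hε M
  obtain ⟨x, hx1, ⟨M1, hM1⟩, hx2⟩ := hz ε hε M
  obtain ⟨y, hy1, ⟨M2, hM2⟩, hy2⟩ := hz' ε hε (M + M1 + 1)
  have hx0 : ∀ j : ℤ, (M1:ℤ) < |j| → x j = 0 := fun j hj => by
    by_contra h; have := (hM1 j h).2; omega
  have hy0 : ∀ j : ℤ, |j| ≤ M + M1 + 1 → y j = 0 := fun j hj => by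
    by_contra h; have := (hM2 j h).1; push_cast at this; omega
  have o1 : inner ℂ x y = (0:ℂ) := aux_orth _ _ fun j => by
    rcases le_or_gt |j| M1 with h | h
    · exact Or.inr (hy0 j (by omega))
    · exact Or.inl (hx0 j h)
  have o2 : inner ℂ x (A y) = (0:ℂ) := aux_orth _ _ fun j => by
    rcases le_or_gt |j| M1 with h | h
    · right
      rw [hA y j, hy0 (j+1) (by rw [abs_le] at *; omega), hy0 (j-1) (by rw [abs_le] at *; omega)]
      simp
    · exact Or.inl (hx0 j h)
  have o3 : inner ℂ y (A x) = (0:ℂ) := aux_orth _ _ fun j => by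
    rcases le_or_gt |j| (M1 + 1) with h | h
    · exact Or.inl (hy0 j (by omega))
    · right
      rw [hA x j, hx0 (j+1) (by rw [lt_abs] at *; omega), hx0 (j-1) (by rw [lt_abs] at *; omega)]
      simp
  have o4 : inner ℂ y x = (0:ℂ) := inner_eq_zero_symm.mp o1
  have st : ((Real.sqrt t : ℝ) : ℂ) * (Real.sqrt t : ℝ) = t := by
    rw [← Complex.ofReal_mul, Real.mul_self_sqrt ht]
  have ss : ((Real.sqrt s : ℝ) : ℂ) * (Real.sqrt s : ℝ) = s := by
    rw [← Complex.ofReal_mul, Real.mul_self_sqrt hs]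
  refine ⟨((Real.sqrt t : ℝ) : ℂ) • x + ((Real.sqrt s : ℝ) : ℂ) • y, ?_, ⟨M1 + M2, ?_⟩, ?_⟩
  · have e : inner ℂ (((Real.sqrt t : ℝ) : ℂ) • x + ((Real.sqrt s : ℝ) : ℂ) • y)
        (((Real.sqrt t : ℝ) : ℂ) • x + ((Real.sqrt s : ℝ) : ℂ) • y) = (1:ℂ) := by
      have ix : inner ℂ x x = (1:ℂ) := by rw [inner_self_eq_norm_sq_to_K, hx1]; simp
      have iy : inner ℂ y y = (1:ℂ) := by rw [inner_self_eq_norm_sq_to_K, hy1]; simp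
      simp only [inner_add_left, inner_add_right, inner_smul_left, inner_smul_right, o1, o4,
        Complex.conj_ofReal, ix, iy]
      have : (t:ℂ) + s = 1 := by exact_mod_cast hts
      linear_combination st + ss + this
    rw [inner_self_eq_norm_sq_to_K] at e
    have e' : ‖((Real.sqrt t : ℝ) : ℂ) • x + ((Real.sqrt s : ℝ) : ℂ) • y‖ ^ 2 = 1 := by
      have e2 : ((‖((Real.sqrt t : ℝ) : ℂ) • x + ((Real.sqrt s : ℝ) : ℂ) • y‖ : ℝ) : ℂ) ^ 2 = 1 := e
      rw [← Complex.ofReal_pow] at e2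
      exact Complex.ofReal_eq_one.mp e2
    exact (pow_eq_one_iff_of_nonneg (norm_nonneg _) two_ne_zero).mp e'
  · intro j hj
    have e : (((Real.sqrt t : ℝ) : ℂ) • x + ((Real.sqrt s : ℝ) : ℂ) • y : Hseq) j =
      ((Real.sqrt t : ℝ) : ℂ) * x j + ((Real.sqrt s : ℝ) : ℂ) * y j := rfl
    rw [e] at hj
    by_cases h : x j = 0
    · have := hM2 j (by rintro h'; rw [h, h'] at hj; simp at hj)
      push_cast at *; omega
    · have := hM1 j h
      push_cast at *; omega
  · have e : inner ℂ (((Real.sqrt t : ℝ) : ℂ) • x + ((Real.sqrt s : ℝ) : ℂ) • y)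
        (A (((Real.sqrt t : ℝ) : ℂ) • x + ((Real.sqrt s : ℝ) : ℂ) • y)) - (t • z + s • z') =
        t * (inner ℂ x (A x) - z) + s * (inner ℂ y (A y) - z') := by
      simp only [map_add, map_smul, inner_add_left, inner_add_right, inner_smul_left,
        inner_smul_right, o2, o3, Complex.conj_ofReal, Complex.real_smul]
      linear_combination (inner ℂ x (A x)) * st + (inner ℂ y (A y)) * ss
    rw [e]
    refine (norm_add_le _ _).trans_lt ?_
    rw [norm_mul, norm_mul, Complex.norm_real, Complex.norm_real, Real.norm_of_nonneg ht,
      Real.norm_of_nonneg hs]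
    rcases ht.eq_or_lt with h | h
    · subst h; simp at hts; subst hts; simpa using hy2
    · have a1 := mul_lt_mul_of_pos_left hx2 h
      have a2 := mul_le_mul_of_nonneg_left hy2.le hs
      have : t * ε + s * ε = ε := by rw [← add_mul, hts, one_mul]
      linarith

lemma aux_G_sub (A : Hseq →L[ℂ] Hseq) : Gset A ⊆ closure (numRange A) := by
  intro z hz
  rw [Metric.mem_closure_iff]
  intro ε hε
  obtain ⟨x, hx, -, h⟩ := hz ε hε 0
  exact ⟨_, ⟨x, hx, rfl⟩, by rwa [dist_comm, dist_eq_norm]⟩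

lemma aux_join {s t : Set ℂ} (hs : IsCompact s) (ht : IsCompact t) :
    IsCompact (convexJoin ℝ s t) := by
  have h := ((isCompact_Icc (a := (0:ℝ)) (b := 1)).prod (hs.prod ht)).image
    (f := fun p : ℝ × ℂ × ℂ => (1 - p.1) • p.2.1 + p.1 • p.2.2) (by fun_prop)
  convert h using 1
  ext z
  rw [mem_convexJoin]
  constructor
  · rintro ⟨a, ha, c, hc, hz⟩
    rw [segment_eq_image] at hz
    obtain ⟨θ, hθ, rfl⟩ := hz
    exact ⟨(θ, a, c), ⟨hθ, ha, hc⟩, rfl⟩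
  · rintro ⟨⟨θ, a, c⟩, ⟨hθ, ha, hc⟩, rfl⟩
    refine ⟨a, ha, c, hc, ?_⟩
    rw [segment_eq_image]
    exact ⟨θ, hθ, rfl⟩

lemma aux_unit_inv (w : ℂ) (hw : ‖w‖ = 1) : w⁻¹ = conj w := by
  rw [Complex.inv_def, Complex.normSq_eq_norm_sq, hw]; simp

lemma aux_mem1 (A0 : Hseq →L[ℂ] Hseq) (hA0 : IsTridiag (fun _ => (0 : ℂ)) A0)
    (A1 : Hseq →L[ℂ] Hseq) (hA1 : IsTridiag (fun _ => (1 : ℂ)) A1) (z : ℂ) :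
    z ∈ spectrum ℂ A1 ↔ ∃ w : ℂ, ‖w‖ = 1 ∧ z = w + conj w := by
  constructor
  · intro hz
    obtain ⟨r, hr⟩ := IsAlgClosed.exists_pow_nat_eq (z ^ 2 - 4) (n := 2) (by norm_num)
    have hprod : (z + r) / 2 * ((z - r) / 2) = 1 := by linear_combination (-1/4) * hr
    have h0 : (z + r) / 2 ≠ 0 := left_ne_zero_of_mul_eq_one hprod
    have hinv : ((z + r) / 2)⁻¹ = (z - r) / 2 := inv_eq_of_mul_eq_one_right hprod
    have hz2 : z = (z + r) / 2 + ((z + r) / 2)⁻¹ := by rw [hinv]; ring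
    have hz3 := hz
    rw [hz2, aux_spec1 A0 hA0 A1 hA1 _ h0] at hz3
    have hn : ‖(z + r) / 2‖ = 1 := by
      rcases hz3 with h | h
      · exact aux_spec0_sub A0 hA0 A1 hA1 _ h
      · have := aux_spec0_sub A0 hA0 A1 hA1 _ h
        rwa [norm_inv, inv_eq_one] at this
    exact ⟨_, hn, by rw [← aux_unit_inv _ hn]; exact hz2⟩
  · rintro ⟨w, hw, rfl⟩
    have h0 : w ≠ 0 := by rintro rfl; simp at hw
    rw [← aux_unit_inv w hw, aux_spec1 A0 hA0 A1 hA1 w h0]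
    exact Or.inl (aux_spec0_sup A0 hA0 w hw)

lemma aux_closed (A0 : Hseq →L[ℂ] Hseq) (hA0 : IsTridiag (fun _ => (0 : ℂ)) A0)
    (A1 : Hseq →L[ℂ] Hseq) (hA1 : IsTridiag (fun _ => (1 : ℂ)) A1) :
    IsClosed (convexHull ℝ (spectrum ℂ A0 ∪ spectrum ℂ A1)) := by
  have e0 : spectrum ℂ A0 = Metric.sphere 0 1 := by
    ext w
    rw [mem_sphere_zero_iff_norm]
    exact ⟨aux_spec0_sub A0 hA0 A1 hA1 w, aux_spec0_sup A0 hA0 w⟩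
  have m2 : (2:ℂ) ∈ spectrum ℂ A1 :=
    (aux_mem1 A0 hA0 A1 hA1 _).mpr ⟨1, by simp, by norm_num⟩
  have m2' : (-2:ℂ) ∈ spectrum ℂ A1 :=
    (aux_mem1 A0 hA0 A1 hA1 _).mpr ⟨-1, by simp, by norm_num⟩
  have e1 : convexHull ℝ (spectrum ℂ A1) = convexHull ℝ {-2, 2} := by
    apply subset_antisymm
    · refine convexHull_min ?_ (convex_convexHull _ _)
      intro z hz
      obtain ⟨w, hw, rfl⟩ := (aux_mem1 A0 hA0 A1 hA1 _).mp hz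
      rw [convexHull_pair]
      have := abs_le.mp ((Complex.abs_re_le_norm w).trans hw.le)
      refine ⟨(1 - w.re) / 2, (1 + w.re) / 2, by linarith, by linarith, by ring, ?_⟩
      rw [Complex.add_conj]
      simp only [Complex.real_smul]
      push_cast
      ring
    · refine convexHull_mono ?_
      rintro z (rfl | rfl)
      · exact m2'
      · exact m2
  rw [convexHull_union (by rw [e0]; exact ⟨1, by simp⟩) ⟨2, m2⟩, e1, e0,
    convexHull_sphere_eq_closedBall _ zero_le_one]
  exact (aux_join (isCompact_closedBall _ _)
    ((Set.toFinite _).isCompact_convexHull ℝ)).isClosed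

theorem stmt8 (b : ℤ → ℂ) (hb : ∀ i, b i = 0 ∨ b i = 1)
    (Ab : Hseq →L[ℂ] Hseq) (hAb : IsTridiag b Ab)
    (A0 : Hseq →L[ℂ] Hseq) (hA0 : IsTridiag (fun _ => (0 : ℂ)) A0)
    (A1 : Hseq →L[ℂ] Hseq) (hA1 : IsTridiag (fun _ => (1 : ℂ)) A1)
    (h0 : (fun _ : ℤ => (0 : ℂ)) ∈ closure (shiftOrbit b))
    (h1 : (fun _ : ℤ => (1 : ℂ)) ∈ closure (shiftOrbit b)) :
    closure (numRange Ab) = convexHull ℝ (spectrum ℂ A0 ∪ spectrum ℂ A1) := by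
  have hcl := aux_closed A0 hA0 A1 hA1
  apply subset_antisymm
  · refine closure_minimal ?_ hcl
    rintro z ⟨x, hx, rfl⟩
    by_contra hn
    obtain ⟨f, u, hf, hu⟩ := geometric_hahn_banach_closed_point (convex_convexHull ℝ _) hcl hn
    have hmem : ∀ (i : ℤ) (w : ℂ), ‖w‖ = 1 → f (w + b i * conj w) < u := by
      intro i w hw
      refine hf _ (subset_convexHull _ _ ?_)
      rcases hb i with h | h
      · left; rw [h, zero_mul, add_zero]; exact aux_spec0_sup A0 hA0 w hw
      · right; rw [h, one_mul]; exact (aux_mem1 A0 hA0 A1 hA1 _).mpr ⟨w, hw, rfl⟩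
    have hu0 : 0 ≤ u := by
      have a1 := hmem 0 1 (by simp)
      have a2 := hmem 0 (-1) (by simp)
      have : (-1 + b 0 * conj (-1 : ℂ)) = - (1 + b 0 * conj (1:ℂ)) := by simp; ring
      rw [this, map_neg] at a2
      linarith
    have hterm : ∀ (i : ℤ) (p : ℂ), f (p + b i * conj p) ≤ ‖p‖ * u := by
      intro i p
      by_cases hp : p = 0
      · subst hp; simp
      have hp' : 0 < ‖p‖ := norm_pos_iff.mpr hp
      have := hmem i (p / ‖p‖) (by rw [norm_div, Complex.norm_real, norm_norm, div_self hp'.ne'])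
      have e : p + b i * conj p = ‖p‖ • (p / ‖p‖ + b i * conj (p / (‖p‖:ℂ))) := by
        have : (‖p‖:ℂ) ≠ 0 := by exact_mod_cast hp'.ne'
        rw [Complex.real_smul, map_div₀, Complex.conj_ofReal]
        field_simp
      rw [e, map_smul, smul_eq_mul]
      exact mul_le_mul_of_nonneg_left this.le hp'.le
    have s1 := (aux_inner b hb Ab hAb A0 hA0 x).mapL f
    have s2 := aux_norm x
    have s3 : HasSum (fun j : ℤ => ‖x (j+1)‖ ^ 2) (‖x‖ ^ 2) :=
      (Equiv.addRight (1:ℤ)).hasSum_iff.mpr s2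
    have s4 := (s2.add s3).mul_left (u / 2)
    have := hasSum_le (fun j => ?_) s1 s4
    · rw [hx] at this; linarith
    · refine (hterm _ _).trans ?_
      rw [norm_mul, RCLike.norm_conj]
      nlinarith [mul_nonneg hu0 (sq_nonneg (‖x j‖ - ‖x (j+1)‖))]
  · refine (convexHull_min ?_ (aux_convex b Ab hAb)).trans (aux_G_sub Ab)
    rintro z (hz | hz)
    · have hn := aux_spec0_sub A0 hA0 A1 hA1 z hz
      have := aux_test b hb Ab hAb A0 hA0 0 (Or.inl rfl) h0 z hn
      simpa using this
    · obtain ⟨w, hw, rfl⟩ := (aux_mem1 A0 hA0 A1 hA1 _).mp hz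
      have := aux_test b hb Ab hAb A0 hA0 1 (Or.inr rfl) h1 w hw
      simpa using this
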